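/- Let f be a measurable function on 𝕋. Then ∫_𝕋 Ψ₀(M(f)(θ)) dθ < ∞ if and only if ∫_𝕋 |f(θ)| log⁺ log⁺ |f(θ)| dθ < ∞. -/

import Mathlib

open MeasureTheory Real ENNReal

/-- `log⁺ s = max (log s) 0`. -/
noncomputable def logPlus (s : ℝ) : ℝ := max (Real.log s) 0

/-- `Ψ₀(t) = t / log(e+t)`, extended by `Ψ₀(∞) = ∞`. -/
noncomputable def Psi0E (t : ℝ≥0∞) : ℝ≥0∞ :=
  t / ENNReal.ofReal (Real.log (Real.exp 1 + t.toReal))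

/-- The Hardy–Littlewood maximal function on the torus: the supremum of averages of `|f|`
over open arcs (represented as intervals `(a,b)` of length at most `2π`) containing `θ`. -/
noncomputable def maximalT (f : ℝ → ℝ) (θ : ℝ) : ℝ≥0∞ :=
  ⨆ (a : ℝ) (b : ℝ) (_ : a < θ) (_ : θ < b) (_ : b - a ≤ 2 * π),
    (ENNReal.ofReal (b - a))⁻¹ * ∫⁻ y in Set.Ioo a b, (‖f y‖₊ : ℝ≥0∞)

theorem exists_dyadic_count (s : ℝ) : ∃ N : ℕ, ∀ k : ℕ, (2 : ℝ) ^ k < s ↔ k < N := by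
  have h : ∃ n : ℕ, s ≤ 2 ^ n := by
    obtain ⟨n, hn⟩ := pow_unbounded_of_one_lt s (one_lt_two)
    exact ⟨n, hn.le⟩
  classical
  refine ⟨Nat.find h, fun k => ⟨fun hk => ?_, fun hk => ?_⟩⟩
  · by_contra! hc
    have h1 := Nat.find_spec h
    have h2 : (2 : ℝ) ^ Nat.find h ≤ 2 ^ k := pow_le_pow_right₀ one_le_two hc
    linarith
  · simpa using Nat.find_min h hk

theorem sum_inv_le_log (N : ℕ) :
    ∑ k ∈ Finset.range N, (1 / ((k : ℝ) + 2)) ≤ Real.log (N + 1) := by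
  induction N with
  | zero => simp
  | succ n ih =>
    rw [Finset.sum_range_succ]
    have hp : (0 : ℝ) < ((n : ℝ) + 2) / (n + 1) := by positivity
    have h := Real.one_sub_inv_le_log_of_pos hp
    rw [Real.log_div (by positivity) (by positivity)] at h
    have e : 1 - (((n : ℝ) + 2) / (n + 1))⁻¹ = 1 / ((n : ℝ) + 2) := by
      field_simp
      ring
    rw [e] at h
    push_cast
    rw [show (n : ℝ) + 1 + 1 = n + 2 by ring]
    linarith

theorem log_le_sum_inv (N : ℕ) :
    Real.log (N + 2) ≤ 1 + ∑ k ∈ Finset.range N, (1 / ((k : ℝ) + 2)) := by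
  induction N with
  | zero =>
    have := Real.log_two_lt_d9
    simp
    linarith
  | succ n ih =>
    rw [Finset.sum_range_succ]
    have hp : (0 : ℝ) < ((n : ℝ) + 3) / (n + 2) := by positivity
    have h := Real.log_le_sub_one_of_pos hp
    rw [Real.log_div (by positivity) (by positivity)] at h
    have e : ((n : ℝ) + 3) / (n + 2) - 1 = 1 / ((n : ℝ) + 2) := by
      field_simp
      ring
    rw [e] at h
    push_cast
    rw [show (n : ℝ) + 1 + 2 = n + 3 by ring]
    linarith

theorem sum_two_pow_div_le (n : ℕ) :
    ∑ k ∈ Finset.range (n + 1), (2 : ℝ) ^ k * (1 / ((k : ℝ) + 2)) ≤ 4 * 2 ^ n / ((n : ℝ) + 2) := by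
  induction n with
  | zero => norm_num
  | succ n ih =>
    rw [Finset.sum_range_succ]
    have h2 : (0 : ℝ) < 2 ^ n := by positivity
    have : (4 : ℝ) * 2 ^ n / (n + 2) + 2 ^ (n + 1) * (1 / (((n + 1 : ℕ) : ℝ) + 2))
        ≤ 4 * 2 ^ (n + 1) / (((n + 1 : ℕ) : ℝ) + 2) := by
      push_cast
      rw [pow_succ, mul_one_div, div_add_div _ _ (by positivity) (by positivity),
        div_le_div_iff₀ (by positivity) (by positivity)]
      have : (0 : ℝ) ≤ n := by positivity
      have h3 : 0 ≤ (2 : ℝ) ^ n * n * (n + 3) := by positivity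
      nlinarith
    linarith

theorem logPlus_logPlus_le_log {s : ℝ} {N : ℕ} (h : s ≤ 2 ^ N) (hs : 0 ≤ s) :
    logPlus (logPlus s) ≤ Real.log (N + 2) := by
  have h0 : 0 ≤ Real.log ((N : ℝ) + 2) := Real.log_nonneg (by linarith [N.cast_nonneg (α := ℝ)])
  have h1 : logPlus s ≤ N := by
    refine max_le ?_ (by positivity)
    rcases hs.eq_or_lt with rfl | hs
    · simp
    · have := Real.log_le_log hs h
      rw [Real.log_pow] at this
      have h2 := Real.log_two_lt_d9
      have : (N : ℝ) * Real.log 2 ≤ N * 1 := by gcongr; linarith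
      linarith
  have h2 : 0 ≤ logPlus s := le_max_right _ _
  refine max_le ?_ h0
  rcases h2.eq_or_lt with h2 | h2
  · rw [← h2]; simpa using h0
  · exact Real.log_le_log h2 (by linarith)

theorem log_le_logPlus_logPlus {s : ℝ} {N : ℕ} (h : ∀ k < N, 2 ^ k < s) :
    Real.log (N + 1) ≤ 3 + logPlus (logPlus s) := by
  have hLL : 0 ≤ logPlus (logPlus s) := le_max_right _ _
  cases N with
  | zero => simp; linarith
  | succ n =>
    have hn := h n (Nat.lt_succ_self n)
    have h1 := Real.log_le_log (by positivity) hn.le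
    rw [Real.log_pow] at h1
    have h2 := Real.log_two_gt_d9
    have h3 : (n : ℝ) ≤ 2 * Real.log s := by
      have : (n : ℝ) * (1 / 2) ≤ n * Real.log 2 := by gcongr; linarith
      linarith
    push_cast
    have hpos : (0 : ℝ) < n + 1 + 1 := by positivity
    by_cases hs : Real.log s ≤ 1
    · have := Real.log_le_sub_one_of_pos hpos
      linarith
    · push Not at hs
      have h4 : Real.log (n + 1 + 1) ≤ Real.log (4 * Real.log s) :=
        Real.log_le_log hpos (by linarith)
      rw [Real.log_mul (by norm_num) (by linarith)] at h4
      have h5 := Real.log_le_sub_one_of_pos (show (0 : ℝ) < 4 by norm_num)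
      have h6 : logPlus s = Real.log s := max_eq_left (by linarith)
      have h7 : Real.log (Real.log s) ≤ logPlus (logPlus s) := by
        rw [h6]; exact le_max_left _ _
      linarith

theorem le_add_mul_logPlus_logPlus {s : ℝ} (hs : 0 ≤ s) :
    s ≤ Real.exp (Real.exp 1) + s * logPlus (logPlus s) := by
  have hLL : 0 ≤ logPlus (logPlus s) := le_max_right _ _
  by_cases h : s ≤ Real.exp (Real.exp 1)
  · have := mul_nonneg hs hLL
    linarith
  · push Not at h
    have h1 : Real.exp 1 ≤ Real.log s := by
      rw [Real.le_log_iff_exp_le ((Real.exp_pos _).trans h)]; exact h.le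
    have h2 : 1 ≤ Real.log (Real.log s) := by
      rw [Real.le_log_iff_exp_le ((Real.exp_pos _).trans_le h1)]; exact h1
    have h6 : logPlus s = Real.log s := max_eq_left ((Real.exp_pos 1).le.trans h1)
    have h7 : 1 ≤ logPlus (logPlus s) := by
      rw [h6]; exact h2.trans (le_max_left _ _)
    have := Real.exp_pos (Real.exp 1)
    nlinarith

/-- The weight `1 / (k + 2)` attached to the dyadic level `2 ^ k`. -/
noncomputable def dyadicWeight (k : ℕ) : ℝ≥0∞ := ENNReal.ofReal (1 / ((k : ℝ) + 2))

theorem two_pow_lt_ofReal {k : ℕ} {s : ℝ} : (2 : ℝ≥0∞) ^ k < ENNReal.ofReal s ↔ (2 : ℝ) ^ k < s := by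
  rw [← ENNReal.ofReal_lt_ofReal_iff_of_nonneg (by positivity), ENNReal.ofReal_pow (by norm_num)]
  simp

theorem tsum_dyadicWeight_eq {s : ℝ} {N : ℕ} (hN : ∀ k : ℕ, (2 : ℝ) ^ k < s ↔ k < N) :
    ∑' k, (if (2 : ℝ≥0∞) ^ k < ENNReal.ofReal s then dyadicWeight k else 0)
      = ENNReal.ofReal (∑ k ∈ Finset.range N, (1 / ((k : ℝ) + 2))) := by
  rw [tsum_eq_sum (s := Finset.range N), ENNReal.ofReal_sum_of_nonneg (fun _ _ => by positivity)]
  · refine Finset.sum_congr rfl fun k hk => ?_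
    rw [if_pos (two_pow_lt_ofReal.2 ((hN k).2 (Finset.mem_range.1 hk)))]
    rfl
  · intro k hk
    rw [if_neg]
    rw [two_pow_lt_ofReal, hN]
    simpa using hk

theorem mul_tsum_dyadicWeight_le {s : ℝ} (hs : 0 ≤ s) :
    ENNReal.ofReal s *
        ∑' k, (if (2 : ℝ≥0∞) ^ k < ENNReal.ofReal s then dyadicWeight k else 0)
      ≤ 4 * ENNReal.ofReal (s * logPlus (logPlus s)) +
        ENNReal.ofReal (3 * Real.exp (Real.exp 1)) := by
  obtain ⟨N, hN⟩ := exists_dyadic_count s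
  have hLL : 0 ≤ logPlus (logPlus s) := le_max_right _ _
  rw [tsum_dyadicWeight_eq hN, ← ENNReal.ofReal_mul hs,
    show (4 : ℝ≥0∞) = ENNReal.ofReal 4 by simp, ← ENNReal.ofReal_mul (by norm_num),
    ← ENNReal.ofReal_add (by positivity) (by positivity)]
  apply ENNReal.ofReal_le_ofReal
  have h1 := (sum_inv_le_log N).trans (log_le_logPlus_logPlus fun k hk => (hN k).2 hk)
  have h2 := mul_le_mul_of_nonneg_left h1 hs
  have h3 := le_add_mul_logPlus_logPlus hs
  linarith

theorem ofReal_mul_logPlus_logPlus_le {s : ℝ} (hs : 0 ≤ s) :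
    ENNReal.ofReal (s * logPlus (logPlus s)) ≤ ENNReal.ofReal s + ENNReal.ofReal s *
        ∑' k, (if (2 : ℝ≥0∞) ^ k < ENNReal.ofReal s then dyadicWeight k else 0) := by
  obtain ⟨N, hN⟩ := exists_dyadic_count s
  have h0 : s ≤ 2 ^ N := by simpa using (hN N).not
  have hS : 0 ≤ ∑ k ∈ Finset.range N, (1 / ((k : ℝ) + 2)) :=
    Finset.sum_nonneg fun _ _ => by positivity
  rw [tsum_dyadicWeight_eq hN, ← ENNReal.ofReal_mul hs,
    ← ENNReal.ofReal_add hs (by positivity)]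
  apply ENNReal.ofReal_le_ofReal
  have h1 := (logPlus_logPlus_le_log h0 hs).trans (log_le_sum_inv N)
  have h2 := mul_le_mul_of_nonneg_left h1 hs
  linarith

theorem one_le_log_exp_one_add {s : ℝ} (hs : 0 ≤ s) : 1 ≤ Real.log (Real.exp 1 + s) := by
  rw [Real.le_log_iff_exp_le (by positivity)]
  linarith

theorem Psi0E_top : Psi0E ⊤ = ⊤ := by
  simp [Psi0E]

theorem Psi0E_ofReal {s : ℝ} (hs : 0 ≤ s) :
    Psi0E (ENNReal.ofReal s) = ENNReal.ofReal (s / Real.log (Real.exp 1 + s)) := by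
  have := one_le_log_exp_one_add hs
  rw [Psi0E, ENNReal.toReal_ofReal hs, ENNReal.ofReal_div_of_pos (by linarith)]

theorem half_le_two_pow_mul_dyadicWeight (k : ℕ) :
    ENNReal.ofReal (1 / 2) ≤ 2 ^ k * dyadicWeight k := by
  rw [dyadicWeight, show (2 : ℝ≥0∞) = ENNReal.ofReal 2 by simp,
    ← ENNReal.ofReal_pow (by norm_num), ← ENNReal.ofReal_mul (by positivity)]
  apply ENNReal.ofReal_le_ofReal
  rw [mul_one_div, div_le_div_iff₀ (by norm_num) (by positivity)]
  have h := one_add_mul_le_pow (show (-2 : ℝ) ≤ 1 by norm_num) k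
  norm_num at h
  have : (0 : ℝ) ≤ k := k.cast_nonneg
  linarith

theorem Psi0E_le_tsum (t : ℝ≥0∞) :
    Psi0E t ≤ 4 + 16 * ∑' k, (if 2 * (2 : ℝ≥0∞) ^ k < t then 2 ^ k * dyadicWeight k else 0) := by
  rcases eq_or_ne t ⊤ with rfl | ht
  · have : ∑' k, (if 2 * (2 : ℝ≥0∞) ^ k < ⊤ then 2 ^ k * dyadicWeight k else 0) = ⊤ := by
      have h : ∑' _ : ℕ, ENNReal.ofReal (1 / 2) = ⊤ :=
        ENNReal.tsum_const_eq_top_of_ne_zero (by simp)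
      refine top_unique (h.ge.trans (ENNReal.tsum_le_tsum fun k => ?_))
      rw [if_pos (ENNReal.mul_lt_top (by simp) (ENNReal.pow_lt_top (by simp)))]
      exact half_le_two_pow_mul_dyadicWeight k
    rw [this]
    simp
  · obtain ⟨s, hs, rfl⟩ : ∃ s : ℝ, 0 ≤ s ∧ t = ENNReal.ofReal s :=
      ⟨t.toReal, ENNReal.toReal_nonneg, (ENNReal.ofReal_toReal ht).symm⟩
    have h1 := one_le_log_exp_one_add hs
    rw [Psi0E_ofReal hs]
    by_cases h4 : s ≤ 4
    · refine le_trans ?_ le_self_add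
      rw [show (4 : ℝ≥0∞) = ENNReal.ofReal 4 by simp]
      exact ENNReal.ofReal_le_ofReal ((div_le_self hs h1).trans h4)
    · push Not at h4
      obtain ⟨n, hn1, hn2⟩ := exists_nat_pow_near (show (1 : ℝ) ≤ s / 4 by linarith) one_lt_two
      have hp : (0 : ℝ) < 2 ^ n := by positivity
      refine le_trans ?_ le_add_self
      refine le_trans ?_ (mul_le_mul_right (ENNReal.le_tsum n) _)
      have hlt : 2 * (2 : ℝ≥0∞) ^ n < ENNReal.ofReal s := by
        rw [← pow_succ', two_pow_lt_ofReal, pow_succ]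
        linarith
      rw [if_pos hlt, dyadicWeight, show (2 : ℝ≥0∞) = ENNReal.ofReal 2 by simp,
        show (16 : ℝ≥0∞) = ENNReal.ofReal 16 by simp,
        ← ENNReal.ofReal_pow (by norm_num), ← ENNReal.ofReal_mul (by positivity),
        ← ENNReal.ofReal_mul (by positivity)]
      apply ENNReal.ofReal_le_ofReal
      have h5 : Real.log (2 ^ (n + 2)) ≤ Real.log (Real.exp 1 + s) := by
        refine Real.log_le_log (by positivity) ?_
        have := Real.exp_pos 1
        rw [pow_add]
        linarith
      rw [Real.log_pow] at h5
      have h6 := Real.log_two_gt_d9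
      have h7 : ((n : ℝ) + 2) / 2 ≤ Real.log (Real.exp 1 + s) := by
        have : ((n : ℝ) + 2) * (1 / 2) ≤ (n + 2) * Real.log 2 := by gcongr; linarith
        push_cast at h5
        linarith
      rw [pow_succ] at hn2
      calc s / Real.log (Real.exp 1 + s) ≤ (8 * 2 ^ n) / (((n : ℝ) + 2) / 2) := by
            gcongr
            linarith
        _ = _ := by field_simp; ring

theorem tsum_le_Psi0E (t : ℝ≥0∞) :
    ∑' k, (if (2 : ℝ≥0∞) ^ k < t then 2 ^ k * dyadicWeight k else 0) ≤ 8 * Psi0E t := by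
  rcases eq_or_ne t ⊤ with rfl | ht
  · simp [Psi0E_top]
  obtain ⟨s, hs, rfl⟩ : ∃ s : ℝ, 0 ≤ s ∧ t = ENNReal.ofReal s :=
    ⟨t.toReal, ENNReal.toReal_nonneg, (ENNReal.ofReal_toReal ht).symm⟩
  have h1 := one_le_log_exp_one_add hs
  obtain ⟨N, hN⟩ := exists_dyadic_count s
  have e : ∑' k, (if (2 : ℝ≥0∞) ^ k < ENNReal.ofReal s then 2 ^ k * dyadicWeight k else 0)
      = ENNReal.ofReal (∑ k ∈ Finset.range N, (2 : ℝ) ^ k * (1 / ((k : ℝ) + 2))) := by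
    rw [tsum_eq_sum (s := Finset.range N), ENNReal.ofReal_sum_of_nonneg (fun _ _ => by positivity)]
    · refine Finset.sum_congr rfl fun k hk => ?_
      rw [if_pos (two_pow_lt_ofReal.2 ((hN k).2 (Finset.mem_range.1 hk))),
        ENNReal.ofReal_mul (by positivity), ENNReal.ofReal_pow (by norm_num)]
      simp [dyadicWeight]
    · intro k hk
      rw [if_neg]
      rw [two_pow_lt_ofReal, hN]
      simpa using hk
  rw [e, Psi0E_ofReal hs, show (8 : ℝ≥0∞) = ENNReal.ofReal 8 by simp,
    ← ENNReal.ofReal_mul (by norm_num)]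
  apply ENNReal.ofReal_le_ofReal
  cases N with
  | zero => simp; positivity
  | succ n =>
    refine (sum_two_pow_div_le n).trans ?_
    have h2 : (2 : ℝ) ^ n < s := (hN n).2 (Nat.lt_succ_self n)
    have h3 : s ≤ 2 ^ (n + 1) := by simpa using (hN (n + 1)).not
    have h4 : Real.log (Real.exp 1 + s) ≤ Real.log (2 ^ (n + 3)) := by
      refine Real.log_le_log (by positivity) ?_
      have := Real.exp_one_lt_d9
      have h5 : (1 : ℝ) ≤ 2 ^ n := one_le_pow₀ one_le_two
      rw [pow_add] at h3 ⊢
      linarith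
    have h6 : Real.log (2 ^ (n + 3)) ≤ 2 * ((n : ℝ) + 2) := by
      rw [Real.log_pow]
      have := Real.log_two_lt_d9
      have : ((n + 3 : ℕ) : ℝ) * Real.log 2 ≤ (n + 3 : ℕ) * 1 := by gcongr; linarith
      push_cast at this ⊢
      have : (0 : ℝ) ≤ n := n.cast_nonneg
      linarith
    calc 4 * 2 ^ n / ((n : ℝ) + 2) = 8 * (2 ^ n / (2 * ((n : ℝ) + 2))) := by field_simp; ring
      _ ≤ 8 * (s / Real.log (Real.exp 1 + s)) := by
        gcongr
        linarith

theorem setLIntegral_Ico_eq_of_periodic {G : ℝ → ℝ≥0∞} {T : ℝ} (hT : 0 < T)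
    (hG : Function.Periodic G T) (c d : ℝ) :
    ∫⁻ x in Set.Ico c (c + T), G x = ∫⁻ x in Set.Ico d (d + T), G x := by
  rw [setLIntegral_congr Ico_ae_eq_Ioc, setLIntegral_congr (Ico_ae_eq_Ioc (a := d))]
  exact (isAddFundamentalDomain_Ioc hT c).setLIntegral_eq (isAddFundamentalDomain_Ioc hT d) G
    hG.map_vadd_zmultiples

/-- An open subset of a bounded interval is the disjoint union of its maximal open subintervals. -/
theorem exists_pairwiseDisjoint_Ioo {V : Set ℝ} {c d : ℝ} (hV : IsOpen V)
    (hsub : V ⊆ Set.Ioo c d) :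
    ∃ S : Set (ℝ × ℝ), S.Countable ∧ S.PairwiseDisjoint (fun p => Set.Ioo p.1 p.2) ∧
      V = ⋃ p ∈ S, Set.Ioo p.1 p.2 ∧ ∀ p ∈ S, p.1 < p.2 ∧ p.1 ∉ V ∧ p.2 ∉ V := by
  set a : ℝ → ℝ := fun q => sSup (Vᶜ ∩ Set.Iic q) with ha
  set b : ℝ → ℝ := fun q => sInf (Vᶜ ∩ Set.Ici q) with hb
  have hA : ∀ q ∈ V, a q ∈ Vᶜ ∩ Set.Iic q := fun q hq =>
    (hV.isClosed_compl.inter isClosed_Iic).csSup_mem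
      ⟨c, fun h => lt_irrefl _ (hsub h).1, (hsub hq).1.le⟩ ⟨q, fun _ h => h.2⟩
  have hB : ∀ q ∈ V, b q ∈ Vᶜ ∩ Set.Ici q := fun q hq =>
    (hV.isClosed_compl.inter isClosed_Ici).csInf_mem
      ⟨d, fun h => lt_irrefl _ (hsub h).2, (hsub hq).2.le⟩ ⟨q, fun _ h => h.2⟩
  have haq : ∀ q ∈ V, a q < q := fun q hq =>
    lt_of_le_of_ne (hA q hq).2 fun h => (hA q hq).1 (by rw [h]; exact hq)
  have hbq : ∀ q ∈ V, q < b q := fun q hq =>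
    lt_of_le_of_ne (hB q hq).2 fun h => (hB q hq).1 (by rw [← h]; exact hq)
  have hI : ∀ q ∈ V, Set.Ioo (a q) (b q) ⊆ V := by
    intro q hq x hx
    by_contra hxV
    rcases le_total x q with h | h
    · exact absurd (le_csSup ⟨q, fun _ h => h.2⟩ (⟨hxV, h⟩ : x ∈ Vᶜ ∩ Set.Iic q)) (not_le.2 hx.1)
    · exact absurd (csInf_le ⟨q, fun _ h => h.2⟩ (⟨hxV, h⟩ : x ∈ Vᶜ ∩ Set.Ici q)) (not_le.2 hx.2)
  have hle : ∀ q ∈ V, ∀ q' ∈ V, ∀ z ∈ Set.Ioo (a q) (b q), z ∈ Set.Ioo (a q') (b q') →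
      a q ≤ a q' ∧ b q' ≤ b q := by
    intro q hq q' hq' z hz hz'
    constructor
    · by_contra! h
      exact (hA q hq).1 (hI q' hq' ⟨h, hz.1.trans hz'.2⟩)
    · by_contra! h
      exact (hB q hq).1 (hI q' hq' ⟨hz'.1.trans hz.2, h⟩)
  refine ⟨(fun q : ℚ => (a q, b q)) '' {q : ℚ | (q : ℝ) ∈ V},
    (Set.to_countable _).image _, ?_, ?_, ?_⟩
  · rintro _ ⟨q, hq, rfl⟩ _ ⟨q', hq', rfl⟩ hne
    refine Set.disjoint_left.2 fun z hz hz' => hne ?_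
    have h1 := hle q hq q' hq' z hz hz'
    have h2 := hle q' hq' q hq z hz' hz
    exact Prod.ext (le_antisymm h1.1 h2.1) (le_antisymm h2.2 h1.2)
  · ext x
    simp only [Set.mem_iUnion, Set.mem_image, exists_prop]
    constructor
    · intro hx
      obtain ⟨q, hq⟩ := exists_rat_btwn (hbq x hx)
      have hqV : (q : ℝ) ∈ V := hI x hx ⟨(haq x hx).trans hq.1, hq.2⟩
      refine ⟨_, ⟨q, hqV, rfl⟩, ?_, hq.1.trans (hbq q hqV)⟩
      by_contra! h
      exact (hA q hqV).1 (hI x hx ⟨(haq x hx).trans_le h, (haq q hqV).trans hq.2⟩)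
    · rintro ⟨_, ⟨q, hq, rfl⟩, hx⟩
      exact hI q hq hx
  · rintro _ ⟨q, hq, rfl⟩
    exact ⟨(haq q hq).trans (hbq q hq), (hA q hq).1, (hB q hq).1⟩

theorem setLIntegral_le_mul_volume_of_forall_Ioo {V : Set ℝ} {c d : ℝ} (hV : IsOpen V)
    (hsub : V ⊆ Set.Ioo c d) (G : ℝ → ℝ≥0∞) (r : ℝ≥0∞)
    (h : ∀ a b, a < b → Set.Ioo a b ⊆ V → a ∉ V →
      ∫⁻ x in Set.Ioo a b, G x ≤ r * ENNReal.ofReal (b - a)) :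
    ∫⁻ x in V, G x ≤ r * volume V := by
  obtain ⟨S, hc, hd, hS, hp⟩ := exists_pairwiseDisjoint_Ioo hV hsub
  have e1 : ∫⁻ x in V, G x = ∑' p : S, ∫⁻ x in Set.Ioo p.1.1 p.1.2, G x := by
    conv_lhs => rw [hS]
    exact lintegral_biUnion hc (fun _ _ => measurableSet_Ioo) hd G
  have e2 : volume V = ∑' p : S, volume (Set.Ioo p.1.1 p.1.2) := by
    conv_lhs => rw [hS]
    exact measure_biUnion hc hd fun _ _ => measurableSet_Ioo
  rw [e1, e2, ← ENNReal.tsum_mul_left]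
  refine ENNReal.tsum_le_tsum fun p => ?_
  rw [Real.volume_Ioo]
  refine h _ _ (hp p p.2).1 ?_ (hp p p.2).2.1
  rw [hS]
  exact Set.subset_biUnion_of_mem (u := fun p : ℝ × ℝ => Set.Ioo p.1 p.2) p.2

/-- A Vitali covering estimate: a set covered by bounded intervals on which the average of `G` is at
least `r` has measure at most `5 / r` times the integral of `G`. -/
theorem mul_volume_le_of_forall_exists_Ioo {E W : Set ℝ} {R : ℝ} (G : ℝ → ℝ≥0∞)
    (r : ℝ≥0∞)
    (h : ∀ x ∈ E, ∃ a b, a < x ∧ x < b ∧ b - a ≤ R ∧ Set.Ioo a b ⊆ W ∧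
      r * ENNReal.ofReal (b - a) ≤ ∫⁻ y in Set.Ioo a b, G y) :
    r * volume E ≤ 5 * ∫⁻ y in W, G y := by
  choose! a b hax hxb hR hW hr using h
  obtain ⟨u, huE, hud, hu⟩ := Vitali.exists_disjoint_subfamily_covering_enlargement_closedBall
    E (fun x => (a x + b x) / 2) (fun x => (b x - a x) / 2) (R / 2)
    (fun x hx => by linarith [hR x hx]) 5 (by norm_num)
  have hball : ∀ x, Metric.closedBall ((a x + b x) / 2) ((b x - a x) / 2) = Set.Icc (a x) (b x) := by
    intro x
    rw [Real.closedBall_eq_Icc]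
    congr 1 <;> ring
  simp only [hball] at hud hu
  have hdI : u.PairwiseDisjoint fun x => Set.Ioo (a x) (b x) :=
    hud.mono fun x => Set.Ioo_subset_Icc_self
  have hcount : u.Countable := hdI.countable_of_isOpen (fun _ _ => isOpen_Ioo)
    fun x hx => ⟨x, hax x (huE hx), hxb x (huE hx)⟩
  have hcov : E ⊆ ⋃ x ∈ u, Metric.closedBall ((a x + b x) / 2) (5 * ((b x - a x) / 2)) := by
    intro x hx
    obtain ⟨y, hy, hxy⟩ := hu x hx
    exact Set.mem_biUnion hy (hxy ⟨(hax x hx).le, (hxb x hx).le⟩)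
  calc r * volume E
      ≤ r * ∑' x : u, volume (Metric.closedBall ((a x + b x) / 2) (5 * ((b x - a x) / 2))) := by
        gcongr
        exact (measure_mono hcov).trans (measure_biUnion_le _ hcount _)
    _ = ∑' x : u, 5 * (r * ENNReal.ofReal (b x - a x)) := by
        rw [← ENNReal.tsum_mul_left]
        refine tsum_congr fun x => ?_
        rw [Real.volume_closedBall, show 2 * (5 * ((b x - a x) / 2)) = 5 * (b x - a x) by ring,
          ENNReal.ofReal_mul (by norm_num)]
        simp only [ENNReal.ofReal_ofNat]
        ring
    _ ≤ ∑' x : u, 5 * ∫⁻ y in Set.Ioo (a x) (b x), G y := by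
        refine ENNReal.tsum_le_tsum fun x => ?_
        gcongr
        exact hr x (huE x.2)
    _ = 5 * ∫⁻ y in ⋃ x ∈ u, Set.Ioo (a x) (b x), G y := by
        rw [ENNReal.tsum_mul_left, lintegral_biUnion hcount (fun _ _ => measurableSet_Ioo) hdI]
    _ ≤ 5 * ∫⁻ y in W, G y := by
        gcongr
        exact Set.iUnion₂_subset fun x hx => hW x (huE hx)

theorem lt_maximalT_iff {f : ℝ → ℝ} {θ : ℝ} {r : ℝ≥0∞} :
    r < maximalT f θ ↔ ∃ a b, a < θ ∧ θ < b ∧ b - a ≤ 2 * π ∧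
      r * ENNReal.ofReal (b - a) < ∫⁻ y in Set.Ioo a b, ‖f y‖ₑ := by
  simp only [maximalT, lt_iSup_iff, exists_prop]
  refine exists_congr fun a => exists_congr fun b => and_congr_right fun ha =>
    and_congr_right fun hb => and_congr_right fun _ => ?_
  have h0 : ENNReal.ofReal (b - a) ≠ 0 := by
    rw [Ne, ENNReal.ofReal_eq_zero]; linarith
  rw [mul_comm, ← div_eq_mul_inv, ENNReal.lt_div_iff_mul_lt (.inl h0) (.inl (by simp))]
  rfl

theorem setLIntegral_Ioo_le_of_maximalT_le {f : ℝ → ℝ} {θ : ℝ} {r : ℝ≥0∞}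
    (h : maximalT f θ ≤ r) {a b : ℝ} (ha : a < θ) (hb : θ < b) (hab : b - a ≤ 2 * π) :
    ∫⁻ y in Set.Ioo a b, ‖f y‖ₑ ≤ r * ENNReal.ofReal (b - a) := by
  by_contra! hc
  exact absurd (lt_maximalT_iff.2 ⟨a, b, ha, hb, hab, hc⟩) (not_lt.2 h)

theorem isOpen_lt_maximalT (f : ℝ → ℝ) (r : ℝ≥0∞) : IsOpen {θ | r < maximalT f θ} := by
  refine isOpen_iff_mem_nhds.2 fun θ hθ => ?_
  obtain ⟨a, b, ha, hb, hab, h⟩ := lt_maximalT_iff.1 hθ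
  filter_upwards [Ioo_mem_nhds ha hb] with x hx
  exact lt_maximalT_iff.2 ⟨a, b, hx.1, hx.2, hab, h⟩

theorem setLIntegral_Ioo_add {G : ℝ → ℝ≥0∞} {T : ℝ} (hG : Function.Periodic G T) (a b : ℝ) :
    ∫⁻ y in Set.Ioo (a + T) (b + T), G y = ∫⁻ y in Set.Ioo a b, G y := by
  rw [← (measurePreserving_add_right volume T).setLIntegral_comp_preimage_emb
    (measurableEmbedding_addRight T)]
  simp [hG _]

theorem maximalT_periodic {f : ℝ → ℝ} (hper : Function.Periodic f (2 * π)) :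
    Function.Periodic (maximalT f) (2 * π) := by
  have key : ∀ T, Function.Periodic f T → ∀ θ, maximalT f θ ≤ maximalT f (θ + T) := by
    intro T hT θ
    refine le_of_forall_lt fun r hr => ?_
    obtain ⟨a, b, ha, hb, hab, h⟩ := lt_maximalT_iff.1 hr
    refine lt_maximalT_iff.2 ⟨a + T, b + T, by linarith, by linarith, by linarith, ?_⟩
    rw [setLIntegral_Ioo_add (G := fun y => ‖f y‖ₑ) (fun y => by simp only [hT y])]
    rwa [add_sub_add_right_eq_sub]
  intro θ
  refine le_antisymm ?_ (key _ hper θ)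
  have := key _ hper.neg (θ + 2 * π)
  rwa [add_neg_cancel_right] at this

theorem setLIntegral_Ioo_three_periods {G : ℝ → ℝ≥0∞} (hG : Function.Periodic G (2 * π)) :
    ∫⁻ y in Set.Ioo (-(2 * π)) (4 * π), G y ≤ 3 * ∫⁻ y in Set.Ico 0 (2 * π), G y := by
  have hpi := Real.pi_pos
  have h := setLIntegral_Ico_eq_of_periodic Real.two_pi_pos hG
  have hs : Set.Ioo (-(2 * π)) (4 * π) ⊆ (Set.Ico (-(2 * π)) (-(2 * π) + 2 * π) ∪
      Set.Ico 0 (0 + 2 * π)) ∪ Set.Ico (2 * π) (2 * π + 2 * π) := by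
    intro x hx
    simp only [Set.mem_union, Set.mem_Ico]
    rcases lt_or_ge x 0 with h0 | h0
    · exact .inl (.inl ⟨hx.1.le, by linarith⟩)
    · rcases lt_or_ge x (2 * π) with h1 | h1
      · exact .inl (.inr ⟨h0, by linarith⟩)
      · exact .inr ⟨h1, by linarith [hx.2]⟩
  refine (lintegral_mono_set hs).trans ((lintegral_union_le _ _ _).trans
    ((add_le_add_left (lintegral_union_le _ _ _) _).trans ?_))
  rw [h (-(2 * π)) 0, h (2 * π) 0, zero_add]
  exact le_of_eq (by ring)

theorem mul_volume_lt_maximalT_le {f : ℝ → ℝ}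
    (hper : Function.Periodic f (2 * π)) {r : ℝ≥0∞} (hr : r ≠ ⊤) :
    r * volume (Set.Ico 0 (2 * π) ∩ {θ | 2 * r < maximalT f θ}) ≤
      15 * ∫⁻ y in Set.Ico 0 (2 * π), (if r < ‖f y‖ₑ then ‖f y‖ₑ else 0) := by
  set G : ℝ → ℝ≥0∞ := fun y => if r < ‖f y‖ₑ then ‖f y‖ₑ else 0 with hGdef
  have hG : Function.Periodic G (2 * π) := fun y => by simp only [hGdef, hper y]
  have hle : ∀ y, ‖f y‖ₑ ≤ G y + r := by
    intro y
    simp only [hGdef]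
    split_ifs with h
    · exact le_self_add
    · simpa using h
  refine (mul_volume_le_of_forall_exists_Ioo (W := Set.Ioo (-(2 * π)) (4 * π)) (R := 2 * π) G r
    ?_).trans ?_
  · rintro x ⟨hx, hM⟩
    obtain ⟨a, b, ha, hb, hab, h⟩ := lt_maximalT_iff.1 hM
    refine ⟨a, b, ha, hb, hab, Set.Ioo_subset_Ioo ?_ ?_, ?_⟩
    · linarith [hx.1]
    · linarith [hx.2]
    · have h2 : ∫⁻ y in Set.Ioo a b, ‖f y‖ₑ ≤
          (∫⁻ y in Set.Ioo a b, G y) + r * ENNReal.ofReal (b - a) := by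
        refine (lintegral_mono hle).trans ?_
        rw [lintegral_add_right _ measurable_const, setLIntegral_const, Real.volume_Ioo]
      have h3 := h.le.trans h2
      rw [mul_assoc, two_mul] at h3
      exact (ENNReal.add_le_add_iff_right (ENNReal.mul_ne_top hr (by simp))).1 h3
  · refine (mul_le_mul_right (setLIntegral_Ioo_three_periods hG) _).trans ?_
    rw [← mul_assoc]
    norm_num

theorem setLIntegral_enorm_ne_top_of_maximalT_ne_top {f : ℝ → ℝ}
    (hper : Function.Periodic f (2 * π)) {θ : ℝ} (h : maximalT f θ ≠ ⊤) :
    ∫⁻ y in Set.Ico 0 (2 * π), ‖f y‖ₑ ≠ ⊤ := by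
  have hpi := Real.pi_pos
  have h1 := setLIntegral_Ioo_le_of_maximalT_le (le_refl (maximalT f θ))
    (a := θ - π) (b := θ - π + 2 * π) (by linarith) (by linarith) (by linarith)
  have h2 := setLIntegral_Ico_eq_of_periodic Real.two_pi_pos (G := fun y => ‖f y‖ₑ)
    (fun y => by simp only [hper y]) (θ - π) 0
  rw [zero_add] at h2
  rw [← h2, setLIntegral_congr Ioo_ae_eq_Ico.symm]
  exact ne_top_of_le_ne_top (ENNReal.mul_ne_top h ENNReal.ofReal_ne_top) h1

theorem ae_enorm_le_maximalT {f : ℝ → ℝ} (hmeas : Measurable f) {c d : ℝ}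
    (hint : ∫⁻ y in Set.Ioo c d, ‖f y‖ₑ ≠ ⊤) :
    ∀ᵐ x, x ∈ Set.Ioo c d → ‖f x‖ₑ ≤ maximalT f x := by
  have hGm : Measurable ((Set.Ioo c d).indicator fun y => ‖f y‖ₑ) :=
    hmeas.enorm.indicator measurableSet_Ioo
  have hGi : ∫⁻ y, (Set.Ioo c d).indicator (fun y => ‖f y‖ₑ) y ≠ ⊤ := by
    rwa [lintegral_indicator measurableSet_Ioo]
  filter_upwards [(Besicovitch.vitaliFamily (volume : Measure ℝ)).ae_tendsto_lintegral_div'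
    hGm hGi] with x hx hxI
  rw [Set.indicator_of_mem hxI] at hx
  refine le_of_tendsto (hx.comp (Besicovitch.tendsto_filterAt volume x)) ?_
  filter_upwards [Ioo_mem_nhdsGT Real.pi_pos] with ρ hρ
  simp only [Function.comp]
  have h1 := setLIntegral_Ioo_le_of_maximalT_le (le_refl (maximalT f x))
    (a := x - ρ) (b := x + ρ) (by linarith [hρ.1]) (by linarith [hρ.1]) (by linarith [hρ.2])
  rw [Real.closedBall_eq_Icc, Real.volume_Icc]
  refine ENNReal.div_le_of_le_mul ?_
  rw [← setLIntegral_congr Ioo_ae_eq_Icc]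
  exact (lintegral_mono fun y => Set.indicator_le_self _ _ y).trans h1

theorem setLIntegral_Ioo_le_of_maximalT_left_le {f : ℝ → ℝ} {a b : ℝ} {r : ℝ≥0∞}
    (h : maximalT f a ≤ r) (hab : a < b) (hb : b - a ≤ 2 * π) :
    ∫⁻ y in Set.Ioo a b, ‖f y‖ₑ ≤ r * ENNReal.ofReal (b - a) := by
  obtain ⟨u, hu, hub, hlim⟩ := exists_seq_strictMono_tendsto' hab
  have hU : Set.Ioo a b = ⋃ n, Set.Ioo a (u n) := by
    ext x
    simp only [Set.mem_iUnion, Set.mem_Ioo]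
    constructor
    · rintro ⟨h1, h2⟩
      obtain ⟨n, hn⟩ := (hlim.eventually (lt_mem_nhds h2)).exists
      exact ⟨n, h1, hn⟩
    · rintro ⟨n, h1, h2⟩
      exact ⟨h1, h2.trans (hub n).2⟩
  rw [hU, setLIntegral_iUnion_of_directed _
    (Monotone.directed_le fun m n hmn => Set.Ioo_subset_Ioo_right (hu.monotone hmn))]
  refine iSup_le fun n => ?_
  have h1 := setLIntegral_Ioo_le_of_maximalT_le h (a := a - (b - u n)) (b := u n)
    (by linarith [(hub n).2]) (hub n).1 (by linarith)
  rw [show u n - (a - (b - u n)) = b - a by ring] at h1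
  exact (lintegral_mono_set (Set.Ioo_subset_Ioo_left (by linarith [(hub n).2]))).trans h1

/-- The reverse weak type inequality, at levels which the maximal function does not exceed
everywhere. -/
theorem setLIntegral_le_mul_volume_lt_maximalT {f : ℝ → ℝ} (hmeas : Measurable f)
    (hper : Function.Periodic f (2 * π)) (hint : ∫⁻ y in Set.Ico 0 (2 * π), ‖f y‖ₑ ≠ ⊤)
    {r : ℝ≥0∞} {c : ℝ} (hc : maximalT f c ≤ r) :
    ∫⁻ y in Set.Ico 0 (2 * π), (if r < ‖f y‖ₑ then ‖f y‖ₑ else 0) ≤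
      r * volume (Set.Ico 0 (2 * π) ∩ {θ | r < maximalT f θ}) := by
  have hM := maximalT_periodic hper
  set U : Set ℝ := {θ | r < maximalT f θ} with hUdef
  have hU : IsOpen U := isOpen_lt_maximalT f r
  have hIoo : ∀ G : ℝ → ℝ≥0∞, Function.Periodic G (2 * π) →
      ∫⁻ y in Set.Ico 0 (2 * π), G y = ∫⁻ y in Set.Ioo c (c + 2 * π), G y := by
    intro G hG
    have := setLIntegral_Ico_eq_of_periodic Real.two_pi_pos hG 0 c
    rw [zero_add] at this
    rw [this, setLIntegral_congr Ioo_ae_eq_Ico]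
  have hvol : volume (Set.Ico 0 (2 * π) ∩ U) = volume (U ∩ Set.Ioo c (c + 2 * π)) := by
    have h1 := hIoo (U.indicator 1) (fun y => by
      simp only [Set.indicator, hUdef, Set.mem_ofPred_eq, hM y, Pi.one_apply])
    rw [lintegral_indicator_one hU.measurableSet, lintegral_indicator_one hU.measurableSet,
      Measure.restrict_apply hU.measurableSet, Measure.restrict_apply hU.measurableSet] at h1
    rw [Set.inter_comm, h1]
  have hint' : ∫⁻ y in Set.Ioo c (c + 2 * π), ‖f y‖ₑ ≠ ⊤ := by
    rwa [← hIoo (fun y => ‖f y‖ₑ) (fun y => by simp only [hper y])]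
  rw [hIoo _ (fun y => by simp only [hper y]), hvol]
  have hV : IsOpen (U ∩ Set.Ioo c (c + 2 * π)) := hU.inter isOpen_Ioo
  calc ∫⁻ y in Set.Ioo c (c + 2 * π), (if r < ‖f y‖ₑ then ‖f y‖ₑ else 0)
      ≤ ∫⁻ y in Set.Ioo c (c + 2 * π), U.indicator (fun y => ‖f y‖ₑ) y := by
        refine lintegral_mono_ae ?_
        rw [ae_restrict_iff' measurableSet_Ioo]
        filter_upwards [ae_enorm_le_maximalT hmeas hint'] with x hx hxI
        split_ifs with h
        · rw [Set.indicator_of_mem (show x ∈ U from h.trans_le (hx hxI))]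
        · exact zero_le
    _ = ∫⁻ y in U ∩ Set.Ioo c (c + 2 * π), ‖f y‖ₑ := by
        rw [setLIntegral_indicator hU.measurableSet]
    _ ≤ _ := by
        refine setLIntegral_le_mul_volume_of_forall_Ioo hV Set.inter_subset_right _ _ ?_
        intro a b hab hsub ha
        obtain ⟨h1, h2⟩ := (Set.Ioo_subset_Ioo_iff hab).1 (hsub.trans Set.inter_subset_right)
        have haU : a ∉ U := by
          rcases h1.eq_or_lt with rfl | h1
          · exact not_lt.2 hc
          · exact fun h => ha ⟨h, h1, hab.trans_le h2⟩
        exact setLIntegral_Ioo_le_of_maximalT_left_le (not_lt.1 haU) hab (by linarith)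

theorem exists_maximalT_le_two_pow {f : ℝ → ℝ} (hper : Function.Periodic f (2 * π))
    (hint : ∫⁻ y in Set.Ico 0 (2 * π), ‖f y‖ₑ ≠ ⊤) :
    ∃ K : ℕ, ∀ k, K ≤ k → ∃ c, maximalT f c ≤ 2 ^ k := by
  have htwo : ENNReal.ofReal (2 * π) ≠ 0 := by
    rw [Ne, ENNReal.ofReal_eq_zero, not_le]
    exact Real.two_pi_pos
  suffices h : ∃ K : ℕ, ∃ c, maximalT f c ≤ 2 ^ K by
    obtain ⟨K, c, hc⟩ := h
    exact ⟨K, fun k hk => ⟨c, hc.trans (pow_le_pow_right₀ one_le_two hk)⟩⟩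
  by_contra! hcon
  have hfin : 15 * ∫⁻ y in Set.Ico 0 (2 * π), ‖f y‖ₑ ≠ ⊤ := ENNReal.mul_ne_top (by simp) hint
  obtain ⟨n, hn⟩ := ENNReal.exists_nat_mul_gt htwo hfin
  have h1 := mul_volume_lt_maximalT_le hper (r := 2 ^ n) (ENNReal.pow_ne_top (by simp))
  rw [Set.inter_eq_left.2 (fun x _ => by
    have := hcon (n + 1) x
    rwa [pow_succ'] at this), Real.volume_Ico, sub_zero] at h1
  have h2 : ∫⁻ y in Set.Ico 0 (2 * π), (if 2 ^ n < ‖f y‖ₑ then ‖f y‖ₑ else 0) ≤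
      ∫⁻ y in Set.Ico 0 (2 * π), ‖f y‖ₑ :=
    lintegral_mono fun y => by split_ifs <;> simp
  have h3 : (n : ℝ≥0∞) ≤ 2 ^ n := by exact_mod_cast Nat.lt_two_pow_self.le
  exact absurd (h1.trans (mul_le_mul_right h2 _))
    (not_le.2 (hn.trans_le (mul_le_mul_left h3 _)))

theorem lintegral_tsum_ite_lt_maximalT (f : ℝ → ℝ) (C : ℝ≥0∞) (w : ℕ → ℝ≥0∞) :
    ∫⁻ θ in Set.Ico 0 (2 * π), ∑' k, (if C * 2 ^ k < maximalT f θ then w k else 0) =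
      ∑' k, w k * volume (Set.Ico 0 (2 * π) ∩ {θ | C * 2 ^ k < maximalT f θ}) := by
  have hm : ∀ k, MeasurableSet {θ | C * 2 ^ k < maximalT f θ} := fun k =>
    (isOpen_lt_maximalT f _).measurableSet
  rw [lintegral_tsum fun k => (Measurable.ite (hm k) measurable_const measurable_const).aemeasurable]
  refine tsum_congr fun k => ?_
  rw [show (fun θ => if C * 2 ^ k < maximalT f θ then w k else 0) =
    {θ | C * 2 ^ k < maximalT f θ}.indicator (fun _ => w k) by
      ext θ; simp [Set.indicator_apply],
    setLIntegral_indicator (hm k), setLIntegral_const, Set.inter_comm]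

theorem tsum_mul_lintegral_ite_lt_enorm {f : ℝ → ℝ} (hmeas : Measurable f) (w : ℕ → ℝ≥0∞) :
    ∑' k, w k * ∫⁻ y in Set.Ico 0 (2 * π), (if 2 ^ k < ‖f y‖ₑ then ‖f y‖ₑ else 0) =
      ∫⁻ y in Set.Ico 0 (2 * π), ‖f y‖ₑ * ∑' k, (if 2 ^ k < ‖f y‖ₑ then w k else 0) := by
  have hm : ∀ k : ℕ, Measurable fun y => if 2 ^ k < ‖f y‖ₑ then ‖f y‖ₑ else 0 := fun k =>
    Measurable.ite (measurableSet_lt measurable_const hmeas.enorm) hmeas.enorm measurable_const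
  simp_rw [← lintegral_const_mul _ (hm _)]
  rw [← lintegral_tsum fun k => ((hm k).const_mul _).aemeasurable]
  refine lintegral_congr fun y => ?_
  rw [← ENNReal.tsum_mul_left]
  refine tsum_congr fun k => ?_
  split_ifs <;> simp [mul_comm]

theorem lintegral_Psi0E_maximalT_lt_top {f : ℝ → ℝ} (hmeas : Measurable f)
    (hper : Function.Periodic f (2 * π))
    (h : ∫⁻ θ in Set.Ico 0 (2 * π), ENNReal.ofReal (|f θ| * logPlus (logPlus |f θ|)) < ⊤) :
    ∫⁻ θ in Set.Ico 0 (2 * π), Psi0E (maximalT f θ) < ⊤ := by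
  have hA : ∫⁻ y in Set.Ico 0 (2 * π),
      ‖f y‖ₑ * ∑' k, (if 2 ^ k < ‖f y‖ₑ then dyadicWeight k else 0) < ⊤ := by
    refine lt_of_le_of_lt (lintegral_mono fun y => ?_) (b := ∫⁻ y in Set.Ico 0 (2 * π),
      (4 * ENNReal.ofReal (|f y| * logPlus (logPlus |f y|)) +
        ENNReal.ofReal (3 * Real.exp (Real.exp 1)))) ?_
    · rw [Real.enorm_eq_ofReal_abs]
      exact mul_tsum_dyadicWeight_le (abs_nonneg _)
    · rw [lintegral_add_right _ measurable_const, lintegral_const_mul' _ _ (by simp),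
        setLIntegral_const, Real.volume_Ico]
      exact ENNReal.add_lt_top.2 ⟨ENNReal.mul_lt_top (by simp) h,
        ENNReal.mul_lt_top ENNReal.ofReal_lt_top ENNReal.ofReal_lt_top⟩
  have hB : ∫⁻ θ in Set.Ico 0 (2 * π),
      ∑' k, (if 2 * 2 ^ k < maximalT f θ then 2 ^ k * dyadicWeight k else 0) < ⊤ := by
    rw [lintegral_tsum_ite_lt_maximalT f 2]
    refine lt_of_le_of_lt ?_ (ENNReal.mul_lt_top (show (15 : ℝ≥0∞) < ⊤ by simp) hA)
    rw [← tsum_mul_lintegral_ite_lt_enorm hmeas, ← ENNReal.tsum_mul_left]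
    refine ENNReal.tsum_le_tsum fun k => ?_
    have := mul_volume_lt_maximalT_le hper (r := 2 ^ k) (ENNReal.pow_ne_top (by simp))
    calc _ = dyadicWeight k * (2 ^ k * volume (Set.Ico 0 (2 * π) ∩
          {θ | 2 * 2 ^ k < maximalT f θ})) := by ring
      _ ≤ _ := mul_le_mul_right this _
      _ = _ := by ring
  refine lt_of_le_of_lt (lintegral_mono fun θ => Psi0E_le_tsum _) ?_
  rw [lintegral_add_left measurable_const, lintegral_const_mul' _ _ (by simp),
    setLIntegral_const, Real.volume_Ico]
  exact ENNReal.add_lt_top.2 ⟨ENNReal.mul_lt_top (by simp) ENNReal.ofReal_lt_top,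
    ENNReal.mul_lt_top (by simp) hB⟩

theorem lintegral_mul_logPlus_logPlus_lt_top {f : ℝ → ℝ} (hmeas : Measurable f)
    (hper : Function.Periodic f (2 * π))
    (h : ∫⁻ θ in Set.Ico 0 (2 * π), Psi0E (maximalT f θ) < ⊤) :
    ∫⁻ θ in Set.Ico 0 (2 * π), ENNReal.ofReal (|f θ| * logPlus (logPlus |f θ|)) < ⊤ := by
  have hint : ∫⁻ y in Set.Ico 0 (2 * π), ‖f y‖ₑ ≠ ⊤ := by
    obtain ⟨θ, hθ⟩ : ∃ θ, maximalT f θ ≠ ⊤ := by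
      by_contra! hcon
      simp only [hcon, Psi0E_top, setLIntegral_const, Real.volume_Ico, sub_zero] at h
      rw [ENNReal.top_mul (by
        rw [Ne, ENNReal.ofReal_eq_zero, not_le]
        exact Real.two_pi_pos)] at h
      exact lt_irrefl _ h
    exact setLIntegral_enorm_ne_top_of_maximalT_ne_top hper hθ
  obtain ⟨K, hK⟩ := exists_maximalT_le_two_pow hper hint
  have hB : ∑' k, 2 ^ k * dyadicWeight k *
      volume (Set.Ico 0 (2 * π) ∩ {θ | 2 ^ k < maximalT f θ}) < ⊤ := by
    have e := lintegral_tsum_ite_lt_maximalT f 1 fun k => 2 ^ k * dyadicWeight k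
    simp only [one_mul] at e
    rw [← e]
    refine lt_of_le_of_lt (lintegral_mono fun θ => tsum_le_Psi0E _) ?_
    rw [lintegral_const_mul' _ _ (by simp)]
    exact ENNReal.mul_lt_top (by simp) h
  have hA : ∫⁻ y in Set.Ico 0 (2 * π),
      ‖f y‖ₑ * ∑' k, (if 2 ^ k < ‖f y‖ₑ then dyadicWeight k else 0) < ⊤ := by
    have hle : ∀ k : ℕ, ∫⁻ y in Set.Ico 0 (2 * π), (if 2 ^ k < ‖f y‖ₑ then ‖f y‖ₑ else 0) ≤
        ∫⁻ y in Set.Ico 0 (2 * π), ‖f y‖ₑ := fun k =>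
      lintegral_mono fun y => by split_ifs <;> simp
    rw [← tsum_mul_lintegral_ite_lt_enorm hmeas, ← ENNReal.summable.sum_add_tsum_nat_add' (k := K)]
    refine ENNReal.add_lt_top.2 ⟨ENNReal.sum_lt_top.2 fun k _ =>
      ENNReal.mul_lt_top ENNReal.ofReal_lt_top ((hle k).trans_lt hint.lt_top), ?_⟩
    refine lt_of_le_of_lt ?_ hB
    refine le_trans ?_ (ENNReal.tsum_comp_le_tsum_of_injective (add_left_injective K) _)
    refine ENNReal.tsum_le_tsum fun k => ?_
    obtain ⟨c, hc⟩ := hK (k + K) (Nat.le_add_left _ _)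
    calc _ ≤ dyadicWeight (k + K) * (2 ^ (k + K) * volume (Set.Ico 0 (2 * π) ∩
          {θ | 2 ^ (k + K) < maximalT f θ})) :=
        mul_le_mul_right (setLIntegral_le_mul_volume_lt_maximalT hmeas hper hint hc) _
      _ = _ := by ring
  refine lt_of_le_of_lt (lintegral_mono fun y => ?_) (b := ∫⁻ y in Set.Ico 0 (2 * π),
    (‖f y‖ₑ + ‖f y‖ₑ * ∑' k, (if 2 ^ k < ‖f y‖ₑ then dyadicWeight k else 0))) ?_
  · rw [Real.enorm_eq_ofReal_abs]
    exact ofReal_mul_logPlus_logPlus_le (abs_nonneg _)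
  · rw [lintegral_add_left hmeas.enorm]
    exact ENNReal.add_lt_top.2 ⟨hint.lt_top, hA⟩

/-- Periodic Stein-type theorem: `M(f) ∈ L_{Ψ₀}(𝕋)` iff `f ∈ L log log L(𝕋)`. -/
theorem stmt15 (f : ℝ → ℝ) (hmeas : Measurable f) (hper : Function.Periodic f (2 * π)) :
    (∫⁻ θ in Set.Ico 0 (2 * π), Psi0E (maximalT f θ)) < ⊤ ↔
      (∫⁻ θ in Set.Ico 0 (2 * π),
        ENNReal.ofReal (|f θ| * logPlus (logPlus |f θ|))) < ⊤ :=
  ⟨lintegral_mul_logPlus_logPlus_lt_top hmeas hper, lintegral_Psi0E_maximalT_lt_top hmeas hper⟩
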